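/- Let X be a compact Polish metric space (with metric ρ), M ⊆ P(X) convex, and r₀ > 0. Then there exists a continuous β : P(X) × X → ℝ which is (M,r₀)-savvy. -/

import Mathlib

open MeasureTheory Filter Set Topology
open scoped NNReal ENNReal

noncomputable section

/-- The completion of the ambient σ-algebra with respect to a measure `μ`:
the σ-algebra of `μ`-null-measurable sets. -/
def completionMS {Y : Type*} [MeasurableSpace Y] (μ : Measure Y) : MeasurableSpace Y where
  MeasurableSet' s := NullMeasurableSet s μ
  measurableSet_empty := MeasurableSet.empty.nullMeasurableSet
  measurableSet_compl := fun _ h => h.compl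
  measurableSet_iUnion := fun _ h => NullMeasurableSet.iUnion h

/-- The σ-algebra of universally measurable sets: the intersection of the completions
of the ambient (Borel) σ-algebra with respect to all probability measures. -/
def univMS (Y : Type*) [MeasurableSpace Y] : MeasurableSpace Y :=
  ⨅ (μ : Measure Y) (_ : IsProbabilityMeasure μ), completionMS μ

/-- The support of a probability measure: the set of points all of whose open
neighbourhoods have positive measure. -/
def msupp {X : Type*} [TopologicalSpace X] [MeasurableSpace X] (μ : ProbabilityMeasure X) :
    Set X :=
  {x | ∀ U : Set X, IsOpen U → x ∈ U → 0 < μ.toMeasure U}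

/-- `ρ` is a metrization of the topological space `X`: it is a metric and the
neighbourhood filters are generated by its open balls. -/
structure IsMetrization {X : Type*} [TopologicalSpace X] (ρ : X → X → ℝ) : Prop where
  refl : ∀ x, ρ x x = 0
  pos : ∀ x y, x ≠ y → 0 < ρ x y
  symm : ∀ x y, ρ x y = ρ y x
  triangle : ∀ x y z, ρ x z ≤ ρ x y + ρ y z
  nhds_basis : ∀ x : X, (nhds x).HasBasis (fun ε : ℝ => 0 < ε) (fun ε => {y | ρ x y < ε})

/-- `f` is Lipschitz with respect to the metric `ρ`. -/
def LipWrt {X : Type*} (ρ : X → X → ℝ) (f : X → ℝ) : Prop :=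
  ∃ K : ℝ, ∀ x y, |f x - f y| ≤ K * ρ x y

/-- The norm `‖f‖_ρ := max_x |f x| + sup_{x ≠ y} |f x - f y| / ρ x y` on Lipschitz functions. -/
def lipNorm {X : Type*} (ρ : X → X → ℝ) (f : X → ℝ) : ℝ :=
  (⨆ x, |f x|) + sSup {c | ∃ x y, x ≠ y ∧ c = |f x - f y| / ρ x y}

/-- The Kantorovich-Rubinstein distance
`D^ρ(μ, ν) := sup {E_μ[f] - E_ν[f] | f Lipschitz, ‖f‖_ρ ≤ 1}`. -/
def KRdist {X : Type*} [MeasurableSpace X] (ρ : X → X → ℝ) (μ ν : ProbabilityMeasure X) : ℝ :=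
  sSup {c | ∃ f : X → ℝ, LipWrt ρ f ∧ lipNorm ρ f ≤ 1 ∧
    c = (∫ x, f x ∂(μ : Measure X)) - ∫ x, f x ∂(ν : Measure X)}

/-- The Kantorovich-Rubinstein distance from a measure to a set of measures. -/
def KRdistSet {X : Type*} [MeasurableSpace X] (ρ : X → X → ℝ) (μ : ProbabilityMeasure X)
    (A : Set (ProbabilityMeasure X)) : ℝ :=
  sInf {c | ∃ ν ∈ A, c = KRdist ρ μ ν}

/-- Convexity for a set of probability measures. -/
def ConvexPM {X : Type*} [MeasurableSpace X] (A : Set (ProbabilityMeasure X)) : Prop :=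
  ∀ μ ∈ A, ∀ ν ∈ A, ∀ p : ℝ≥0, p ≤ 1 → ∀ ξ : ProbabilityMeasure X,
    (ξ : Measure X) = p • (μ : Measure X) + (1 - p) • (ν : Measure X) → ξ ∈ A

/-- `κ` is a regular conditional probability for `μ` given `π`: it is a measurable family
of probability measures which disintegrates `μ` over `π_* μ` and is concentrated on fibers. -/
def IsRCP {X Y : Type*} [MeasurableSpace X] [MeasurableSpace Y]
    (μ : Measure X) (π : X → Y) (κ : Y → ProbabilityMeasure X) : Prop :=
  Measurable (fun y => (κ y : Measure X)) ∧
  (∀ s : Set X, MeasurableSet s → ∀ t : Set Y, MeasurableSet t →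
    μ (s ∩ π ⁻¹' t) = ∫⁻ y in t, (κ y : Measure X) s ∂(μ.map π)) ∧
  (∀ᵐ y ∂(μ.map π), (κ y : Measure X) (π ⁻¹' {y}) = 1)

/-- `N` is a regular upper bound for `M | π` (Definition 2.2 of the paper). -/
structure IsRUB {X Y : Type*} [TopologicalSpace X] [TopologicalSpace Y]
    [MeasurableSpace X] [MeasurableSpace Y] [OpensMeasurableSpace X]
    (π : X → Y) (M : Set (ProbabilityMeasure X)) (N : Y → Set (ProbabilityMeasure X)) : Prop where
  closed : IsClosed {p : Y × ProbabilityMeasure X | p.2 ∈ N p.1}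
  convex : ∀ y, ConvexPM (N y)
  cond : ∀ μ ∈ M, ∀ κ : Y → ProbabilityMeasure X, IsRCP (μ : Measure X) π κ →
    ∀ᵐ y ∂((μ : Measure X).map π), κ y ∈ N y

/-- `β` is an `(M, r₀)`-savvy bet (with respect to the metric `ρ`). -/
def IsSavvy {X : Type*} [TopologicalSpace X] [MeasurableSpace X] [OpensMeasurableSpace X]
    (ρ : X → X → ℝ) (M : Set (ProbabilityMeasure X)) (r₀ : ℝ)
    (β : ProbabilityMeasure X × X → ℝ) : Prop :=
  Continuous β ∧
  ∀ μ : ProbabilityMeasure X,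
    (∀ x, |β (μ, x)| ≤ max (KRdistSet ρ μ M - r₀) 0) ∧
    ∀ ν ∈ M, (1/2) * (KRdistSet ρ μ M - r₀) * KRdistSet ρ μ M ≤
      (∫ x, β (μ, x) ∂(ν : Measure X)) - ∫ x, β (μ, x) ∂(μ : Measure X)

/-- Borel σ-algebra on the space of probability measures (with its weak topology). -/
instance {X : Type*} [TopologicalSpace X] [MeasurableSpace X] [OpensMeasurableSpace X] :
    MeasurableSpace (ProbabilityMeasure X) := borel _

/-- Borel σ-algebra on a space of continuous functions. -/
instance {Y : Type*} [TopologicalSpace Y] : MeasurableSpace C(Y, ℝ) := borel _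

end

/-- The bounded continuous functions that are bounded by `1` and `1`-Lipschitz. -/
def lipBall (X : Type*) [MetricSpace X] : Set (BoundedContinuousFunction X ℝ) :=
  {f | (∀ x, |f x| ≤ 1) ∧ ∀ x y, |f x - f y| ≤ dist x y}

theorem isCompact_lipBall (X : Type*) [MetricSpace X] [CompactSpace X] :
    IsCompact (lipBall X) := by
  refine BoundedContinuousFunction.arzela_ascoli₂ (Set.Icc (-1 : ℝ) 1) isCompact_Icc _ ?_
    (fun f x hf => abs_le.1 (hf.1 x)) ?_
  · have h : ∀ x : X, Continuous fun f : BoundedContinuousFunction X ℝ => f x :=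
      fun x => continuous_eval_const x
    simp only [lipBall, ofPred_and, ofPred_forall]
    refine (isClosed_iInter fun x => isClosed_le (h x).abs continuous_const).inter
      (isClosed_iInter fun x => isClosed_iInter fun y =>
        isClosed_le ((h x).sub (h y)).abs continuous_const)
  · refine Metric.equicontinuous_of_continuity_modulus id tendsto_id _ fun x y f => ?_
    exact f.2.2 x y

theorem convex_lipBall (X : Type*) [MetricSpace X] : Convex ℝ (lipBall X) := by
  intro f hf g hg a b ha hb hab
  refine ⟨fun x => ?_, fun x y => ?_⟩
  · have h1 := abs_le.1 (hf.1 x)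
    have h2 := abs_le.1 (hg.1 x)
    simp only [BoundedContinuousFunction.coe_add, BoundedContinuousFunction.coe_smul,
      Pi.add_apply, smul_eq_mul]
    rw [abs_le]
    constructor <;> nlinarith
  · have h1 := abs_le.1 (hf.2 x y)
    have h2 := abs_le.1 (hg.2 x y)
    simp only [BoundedContinuousFunction.coe_add, BoundedContinuousFunction.coe_smul,
      Pi.add_apply, smul_eq_mul]
    have hd : dist x y = a * dist x y + b * dist x y := by rw [← add_mul, hab, one_mul]
    rw [abs_le]
    constructor <;> nlinarith

theorem zero_mem_lipBall (X : Type*) [MetricSpace X] : 0 ∈ lipBall X :=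
  ⟨fun x => by simp, fun x y => by simp⟩

theorem neg_mem_lipBall {X : Type*} [MetricSpace X] {f : BoundedContinuousFunction X ℝ}
    (hf : f ∈ lipBall X) : -f ∈ lipBall X := by
  refine ⟨fun x => by simpa using hf.1 x, fun x y => ?_⟩
  have := hf.2 y x
  rw [dist_comm]
  simpa [neg_add_eq_sub] using this

/-- A Lipschitz function with `‖f‖_ρ ≤ 1` is given by an element of `lipBall X`. -/
theorem exists_mem_lipBall_of_lipNorm_le {X : Type*} [MetricSpace X] [CompactSpace X]
    {f : X → ℝ} (hf : LipWrt dist f) (hn : lipNorm dist f ≤ 1) :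
    ∃ g ∈ lipBall X, ∀ x, g x = f x := by
  obtain ⟨K, hK⟩ := hf
  have hc : Continuous f := by
    refine (LipschitzWith.of_dist_le_mul (K := K.toNNReal) fun x y => ?_).continuous
    rw [Real.dist_eq]
    exact (hK x y).trans (mul_le_mul_of_nonneg_right (Real.le_coe_toNNReal K) dist_nonneg)
  have hbdd : BddAbove (Set.range fun x => |f x|) := (isCompact_range hc.abs).bddAbove
  have hquot : BddAbove {c | ∃ x y, x ≠ y ∧ c = |f x - f y| / dist x y} := by
    refine ⟨K, ?_⟩
    rintro _ ⟨x, y, hxy, rfl⟩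
    rw [div_le_iff₀ (dist_pos.2 hxy)]
    exact hK x y
  have h1 : 0 ≤ ⨆ x, |f x| := Real.iSup_nonneg fun x => abs_nonneg _
  have h2 : 0 ≤ sSup {c | ∃ x y, x ≠ y ∧ c = |f x - f y| / dist x y} := by
    refine Real.sSup_nonneg ?_
    rintro _ ⟨x, y, hxy, rfl⟩
    positivity
  unfold lipNorm at hn
  refine ⟨BoundedContinuousFunction.mkOfCompact ⟨f, hc⟩, ⟨fun x => ?_, fun x y => ?_⟩,
    fun x => rfl⟩
  · have := le_ciSup hbdd x
    change |f x| ≤ 1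
    linarith
  · change |f x - f y| ≤ dist x y
    rcases eq_or_ne x y with rfl | hxy
    · simp
    · have := le_csSup hquot ⟨x, y, hxy, rfl⟩
      have h3 : |f x - f y| / dist x y ≤ 1 := by linarith
      rwa [div_le_one (dist_pos.2 hxy)] at h3

theorem abs_integral_le_one_of_lipBall {X : Type*} [MetricSpace X] [MeasurableSpace X]
    {f : BoundedContinuousFunction X ℝ} (hf : f ∈ lipBall X)
    (μ : ProbabilityMeasure X) : |∫ x, f x ∂(μ : Measure X)| ≤ 1 := by
  have := norm_integral_le_of_norm_le_const (μ := (μ : Measure X)) (f := f) (C := 1)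
    (ae_of_all _ hf.1)
  simpa using this

section IntegralFunctional

variable {X : Type*} [MetricSpace X] [MeasurableSpace X] [BorelSpace X]

/-- Integrals against probability measures are `1`-Lipschitz for the supremum norm. -/
theorem abs_integral_sub_integral_le (f g : BoundedContinuousFunction X ℝ)
    (μ : ProbabilityMeasure X) :
    |(∫ x, f x ∂(μ : Measure X)) - ∫ x, g x ∂(μ : Measure X)| ≤ dist f g := by
  rw [← integral_sub (f.integrable _) (g.integrable _)]
  have := norm_integral_le_of_norm_le_const (μ := (μ : Measure X)) (f := fun x => f x - g x)
    (C := dist f g) (ae_of_all _ fun x => by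
      rw [← dist_eq_norm]
      exact BoundedContinuousFunction.dist_coe_le_dist x)
  simpa using this

theorem continuous_integral_bcf (μ : ProbabilityMeasure X) :
    Continuous fun f : BoundedContinuousFunction X ℝ => ∫ x, f x ∂(μ : Measure X) := by
  refine (LipschitzWith.of_dist_le_mul (K := 1) fun f g => ?_).continuous
  simpa [Real.dist_eq] using abs_integral_sub_integral_le f g μ

theorem integral_add_smul_bcf (μ : ProbabilityMeasure X) (f g : BoundedContinuousFunction X ℝ)
    (a b : ℝ) : ∫ x, (a • f + b • g) x ∂(μ : Measure X)
      = a * (∫ x, f x ∂(μ : Measure X)) + b * ∫ x, g x ∂(μ : Measure X) := by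
  simp only [BoundedContinuousFunction.coe_add, BoundedContinuousFunction.coe_smul,
      Pi.add_apply, smul_eq_mul]
  rw [integral_add ((f.integrable _).const_mul a) ((g.integrable _).const_mul b),
    integral_const_mul, integral_const_mul]

/-- The functionals on bounded continuous functions induced by a convex set of measures form
a convex set. -/
theorem ConvexPM.convex_integral_image {M : Set (ProbabilityMeasure X)} (hconv : ConvexPM M) :
    Convex ℝ ((fun (ν : ProbabilityMeasure X) (f : BoundedContinuousFunction X ℝ) =>
      ∫ x, f x ∂(ν : Measure X)) '' M) := by
  rintro _ ⟨ν₁, h₁, rfl⟩ _ ⟨ν₂, h₂, rfl⟩ a b ha hb hab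
  lift a to ℝ≥0 using ha
  lift b to ℝ≥0 using hb
  have hab' : a + b = 1 := by exact_mod_cast hab
  have hb' : b = 1 - a := by rw [← hab', add_tsub_cancel_left]
  have hprob : IsProbabilityMeasure (a • (ν₁ : Measure X) + b • (ν₂ : Measure X)) := by
    constructor
    simp only [Measure.coe_add, Pi.add_apply, Measure.smul_apply, measure_univ,
      ENNReal.smul_def, smul_eq_mul, mul_one]
    exact_mod_cast hab'
  refine ⟨⟨_, hprob⟩, hconv ν₁ h₁ ν₂ h₂ a (hab' ▸ le_self_add) _ (by rw [← hb']; rfl), ?_⟩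
  funext f
  change ∫ x, f x ∂(a • (ν₁ : Measure X) + b • (ν₂ : Measure X)) = _
  rw [integral_add_measure ((f.integrable _).smul_measure_nnreal)
    ((f.integrable _).smul_measure_nnreal), integral_smul_nnreal_measure,
    integral_smul_nnreal_measure]
  rfl

end IntegralFunctional

section KRdist

variable {X : Type*} [MetricSpace X] [MeasurableSpace X] [CompactSpace X]

theorem KRdist_le_of_forall_lipBall {μ ν : ProbabilityMeasure X} {c : ℝ}
    (h : ∀ f ∈ lipBall X, (∫ x, f x ∂(μ : Measure X)) - ∫ x, f x ∂(ν : Measure X) ≤ c) :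
    KRdist dist μ ν ≤ c := by
  refine Real.sSup_le ?_ (by simpa using h 0 (zero_mem_lipBall X))
  rintro _ ⟨f, hf, hn, rfl⟩
  obtain ⟨g, hg, hgf⟩ := exists_mem_lipBall_of_lipNorm_le hf hn
  simpa only [hgf] using h g hg

theorem bddAbove_KRdist (μ ν : ProbabilityMeasure X) :
    BddAbove {c | ∃ f : X → ℝ, LipWrt dist f ∧ lipNorm dist f ≤ 1 ∧
      c = (∫ x, f x ∂(μ : Measure X)) - ∫ x, f x ∂(ν : Measure X)} := by
  refine ⟨2, ?_⟩
  rintro _ ⟨f, hf, hn, rfl⟩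
  obtain ⟨g, hg, hgf⟩ := exists_mem_lipBall_of_lipNorm_le hf hn
  have h1 := abs_le.1 (abs_integral_le_one_of_lipBall hg μ)
  have h2 := abs_le.1 (abs_integral_le_one_of_lipBall hg ν)
  simp only [hgf] at h1 h2
  linarith

theorem KRdist_nonneg (μ ν : ProbabilityMeasure X) : 0 ≤ KRdist dist μ ν := by
  refine le_csSup (bddAbove_KRdist μ ν) ⟨fun _ => 0, ⟨0, by simp⟩, ?_, by simp⟩
  have h : sSup {c : ℝ | ∃ x y : X, x ≠ y ∧ c = |(0 : ℝ) - 0| / dist x y} ≤ 1 := by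
    refine Real.sSup_le ?_ zero_le_one
    rintro _ ⟨x, y, -, rfl⟩
    simp
  simpa [lipNorm] using h

theorem KRdist_le_add {μ μ' : ProbabilityMeasure X} (ν : ProbabilityMeasure X) {ε : ℝ}
    (h : ∀ f ∈ lipBall X, (∫ x, f x ∂(μ : Measure X)) - ∫ x, f x ∂(μ' : Measure X) ≤ ε) :
    KRdist dist μ ν ≤ KRdist dist μ' ν + ε := by
  have hε : 0 ≤ ε := by simpa using h 0 (zero_mem_lipBall X)
  refine Real.sSup_le ?_ (add_nonneg (KRdist_nonneg _ _) hε)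
  rintro _ ⟨f, hf, hn, rfl⟩
  obtain ⟨g, hg, hgf⟩ := exists_mem_lipBall_of_lipNorm_le hf hn
  have h1 := le_csSup (bddAbove_KRdist μ' ν) ⟨f, hf, hn, rfl⟩
  have h2 := h g hg
  simp only [hgf] at h2
  change _ ≤ KRdist dist μ' ν at h1
  linarith

theorem bddBelow_KRdistSet (μ : ProbabilityMeasure X) (M : Set (ProbabilityMeasure X)) :
    BddBelow {c | ∃ ν ∈ M, c = KRdist dist μ ν} := by
  refine ⟨0, ?_⟩
  rintro _ ⟨ν, -, rfl⟩
  exact KRdist_nonneg μ ν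

theorem KRdistSet_le {μ ν : ProbabilityMeasure X} {M : Set (ProbabilityMeasure X)} (hν : ν ∈ M) :
    KRdistSet dist μ M ≤ KRdist dist μ ν :=
  csInf_le (bddBelow_KRdistSet μ M) ⟨ν, hν, rfl⟩

theorem KRdistSet_le_add {μ μ' : ProbabilityMeasure X} {M : Set (ProbabilityMeasure X)}
    (hM : M.Nonempty) {ε : ℝ}
    (h : ∀ f ∈ lipBall X, (∫ x, f x ∂(μ : Measure X)) - ∫ x, f x ∂(μ' : Measure X) ≤ ε) :
    KRdistSet dist μ M ≤ KRdistSet dist μ' M + ε := by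
  rw [← sub_le_iff_le_add]
  obtain ⟨ν₀, hν₀⟩ := hM
  refine le_csInf ⟨_, ν₀, hν₀, rfl⟩ ?_
  rintro _ ⟨ν, hν, rfl⟩
  have h1 := KRdistSet_le (μ := μ) hν
  have h2 := KRdist_le_add ν h
  linarith

end KRdist

section Separation

variable {X : Type*} [MetricSpace X] [MeasurableSpace X] [CompactSpace X] [BorelSpace X]

/-- Weak convergence is uniform over `lipBall X`. -/
theorem eventually_forall_lipBall (μ₀ : ProbabilityMeasure X) {ε : ℝ} (hε : 0 < ε) :
    ∀ᶠ μ : ProbabilityMeasure X in 𝓝 μ₀, ∀ f ∈ lipBall X,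
      |(∫ x, f x ∂(μ : Measure X)) - ∫ x, f x ∂(μ₀ : Measure X)| < ε := by
  obtain ⟨t, -, ht, hcov⟩ := Metric.finite_approx_of_totallyBounded
    (isCompact_lipBall X).totallyBounded (ε / 3) (by positivity)
  have hev : ∀ᶠ μ : ProbabilityMeasure X in 𝓝 μ₀, ∀ g ∈ t,
      |(∫ x, g x ∂(μ : Measure X)) - ∫ x, g x ∂(μ₀ : Measure X)| < ε / 3 := by
    rw [Filter.eventually_all_finite ht]
    intro g _
    have := (ProbabilityMeasure.continuous_integral_boundedContinuousFunction g).tendsto μ₀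
    exact (Metric.tendsto_nhds.1 this (ε / 3) (by positivity))
  filter_upwards [hev] with μ hμ f hf
  obtain ⟨g, hg, hfg⟩ := mem_iUnion₂.1 (hcov hf)
  have hd : dist f g < ε / 3 := hfg
  have h1 := abs_le.1 (abs_integral_sub_integral_le f g μ)
  have h2 := abs_le.1 (abs_integral_sub_integral_le f g μ₀)
  have h3 := abs_lt.1 (hμ g hg)
  rw [abs_lt]
  constructor <;> linarith

theorem continuous_KRdistSet {M : Set (ProbabilityMeasure X)} (hM : M.Nonempty) :
    Continuous fun μ : ProbabilityMeasure X => KRdistSet dist μ M := by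
  refine continuous_iff_continuousAt.2 fun μ₀ => Metric.tendsto_nhds.2 fun ε hε => ?_
  filter_upwards [eventually_forall_lipBall μ₀ (half_pos hε)] with μ hμ
  have h1 := KRdistSet_le_add (μ := μ) (μ' := μ₀) hM fun f hf => (abs_lt.1 (hμ f hf)).2.le
  have h2 := KRdistSet_le_add (μ := μ₀) (μ' := μ) (ε := ε / 2) hM fun f hf => by
    linarith [(abs_lt.1 (hμ f hf)).1]
  rw [Real.dist_eq, abs_lt]
  constructor <;> linarith

/-- Minimax: if `t` is below the distance from `μ` to the convex set `M`, a single function in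
`lipBall X` separates `μ` from all of `M` by at least `t`. -/
theorem exists_lipBall_separating {M : Set (ProbabilityMeasure X)} (hconv : ConvexPM M)
    (μ : ProbabilityMeasure X) {t : ℝ} (ht : t < KRdistSet dist μ M) :
    ∃ f ∈ lipBall X, ∀ ν ∈ M,
      t ≤ (∫ x, f x ∂(ν : Measure X)) - ∫ x, f x ∂(μ : Measure X) := by
  by_contra! hcon
  have : Nonempty (ProbabilityMeasure X) := ⟨μ⟩
  choose! N hNM hN using hcon
  let J : ProbabilityMeasure X → BoundedContinuousFunction X ℝ → ℝ :=
    fun ν f => ∫ x, f x ∂(ν : Measure X)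
  have hJ : ∀ ν, Continuous (J ν) := continuous_integral_bcf
  obtain ⟨s, hs, hcov⟩ := (isCompact_lipBall X).elim_nhds_subcover
    (fun f => {g | J (N f) g - J μ g < t})
    (fun f hf => (isOpen_lt ((hJ _).sub (hJ _)) continuous_const).mem_nhds (hN f hf))
  obtain ⟨_, ⟨ν, hν, rfl⟩, hlt⟩ := Sion.exists_lt_iInf_of_lt_iInf_of_finite
    (X := lipBall X) (Y := J '' M) (f := fun g L => J μ g - L g) (t := -t)
    (s := (fun f => J (N f)) '' (s : Set (BoundedContinuousFunction X ℝ)))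
    ⟨0, zero_mem_lipBall X⟩ (isCompact_lipBall X)
    (by
      rintro _ ⟨ν, -, rfl⟩
      exact ((hJ μ).sub (hJ ν)).lowerSemicontinuous.lowerSemicontinuousOn _)
    (by
      rintro _ ⟨ν, -, rfl⟩
      refine ConvexOn.quasiconvexOn ⟨convex_lipBall X, fun f _ g _ a b _ _ _ => le_of_eq ?_⟩
      simp only [J, integral_add_smul_bcf, smul_eq_mul]
      ring)
    hconv.convex_integral_image
    (fun g _ => (continuous_const.sub
      (continuous_apply g)).upperSemicontinuous.upperSemicontinuousOn _)
    (fun g _ => by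
      refine ConcaveOn.quasiconcaveOn
        ⟨hconv.convex_integral_image, fun L _ L' _ a b _ _ hab => le_of_eq ?_⟩
      simp only [Pi.add_apply, Pi.smul_apply, smul_eq_mul]
      linear_combination J μ g * hab)
    (convex_lipBall X)
    (s.finite_toSet.image _)
    (by
      rintro _ ⟨f, hf, rfl⟩
      exact ⟨N f, hNM f (hs f hf), rfl⟩)
    (by
      intro g hg
      obtain ⟨f, hf, hfg⟩ := mem_iUnion₂.1 (hcov hg)
      have hfg' : J (N f) g - J μ g < t := hfg
      exact ⟨_, ⟨f, hf, rfl⟩, by linarith⟩)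
  refine ht.not_ge ((KRdistSet_le hν).trans (KRdist_le_of_forall_lipBall fun f hf => ?_))
  have h := hlt _ (neg_mem_lipBall hf)
  simp only [J, BoundedContinuousFunction.coe_neg, Pi.neg_apply, integral_neg] at h
  linarith

/-- A continuous choice of functions separating `μ` from `M` at least by half of the distance. -/
theorem exists_continuous_separating {M : Set (ProbabilityMeasure X)} (hconv : ConvexPM M)
    (hM : M.Nonempty) {r₀ : ℝ} (hr₀ : 0 < r₀) :
    ∃ g : C(ProbabilityMeasure X, BoundedContinuousFunction X ℝ), ∀ μ,
      g μ ∈ lipBall X ∧ (r₀ ≤ KRdistSet dist μ M → ∀ ν ∈ M, (1 / 2) * KRdistSet dist μ M ≤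
        (∫ x, g μ x ∂(ν : Measure X)) - ∫ x, g μ x ∂(μ : Measure X)) := by
  have hr := continuous_KRdistSet hM
  refine exists_continuous_forall_mem_convex_of_local_const
    (t := fun μ => {f | f ∈ lipBall X ∧ (r₀ ≤ KRdistSet dist μ M → ∀ ν ∈ M,
      (1 / 2) * KRdistSet dist μ M ≤
        (∫ x, f x ∂(ν : Measure X)) - ∫ x, f x ∂(μ : Measure X))}) ?_ ?_
  · intro μ f hf g hg a b ha hb hab
    refine ⟨convex_lipBall X hf.1 hg.1 ha hb hab, fun h ν hν => ?_⟩
    have h1 := mul_le_mul_of_nonneg_left (hf.2 h ν hν) ha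
    have h2 := mul_le_mul_of_nonneg_left (hg.2 h ν hν) hb
    rw [integral_add_smul_bcf, integral_add_smul_bcf]
    linear_combination h1 + h2 - (1 / 2) * KRdistSet dist μ M * hab
  · intro μ₀
    rcases lt_or_ge (KRdistSet dist μ₀ M) r₀ with h | h
    · refine ⟨0, ?_⟩
      filter_upwards [hr.tendsto μ₀ |>.eventually_lt_const h] with μ hμ
      exact ⟨zero_mem_lipBall X, fun h' => absurd h' hμ.not_ge⟩
    · have hpos : 0 < KRdistSet dist μ₀ M := hr₀.trans_le h
      obtain ⟨f, hf, hsep⟩ := exists_lipBall_separating hconv μ₀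
        (t := (3 / 4) * KRdistSet dist μ₀ M) (by linarith)
      refine ⟨f, ?_⟩
      have hcont : Continuous fun μ : ProbabilityMeasure X =>
          (1 / 2) * KRdistSet dist μ M + ∫ x, f x ∂(μ : Measure X) :=
        (hr.const_mul _).add
          (ProbabilityMeasure.continuous_integral_boundedContinuousFunction f)
      filter_upwards [(hcont.tendsto μ₀).eventually_lt_const
        (show _ < (3 / 4) * KRdistSet dist μ₀ M + ∫ x, f x ∂(μ₀ : Measure X) by linarith)]
        with μ hμ
      refine ⟨hf, fun _ ν hν => ?_⟩
      have := hsep ν hν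
      linarith

end Separation

/-- Corollary 5.4 of the paper: for any convex `M ⊆ P(X)` and `r₀ > 0`
there exists a continuous `(M, r₀)`-savvy bet. -/
theorem statement15 {X : Type*} [MetricSpace X] [CompactSpace X]
    [MeasurableSpace X] [BorelSpace X]
    (M : Set (ProbabilityMeasure X)) (hconv : ConvexPM M) (r₀ : ℝ) (hr₀ : 0 < r₀) :
    ∃ β : ProbabilityMeasure X × X → ℝ, IsSavvy dist M r₀ β := by
  rcases M.eq_empty_or_nonempty with rfl | hM
  · exact ⟨fun _ => 0, continuous_const, fun μ => ⟨fun x => by simp, fun ν hν => hν.elim⟩⟩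
  obtain ⟨g, hg⟩ := exists_continuous_separating hconv hM hr₀
  refine ⟨fun p => max (KRdistSet dist p.1 M - r₀) 0 * g p.1 p.2, ?_, fun μ => ⟨fun x => ?_,
    fun ν hν => ?_⟩⟩
  · have h1 := (continuous_KRdistSet hM).comp (continuous_fst (X := ProbabilityMeasure X) (Y := X))
    have h2 : Continuous fun p : ProbabilityMeasure X × X => g p.1 p.2 :=
      continuous_eval.comp
        ((g.continuous.comp continuous_fst).prodMk continuous_snd)
    exact ((h1.sub continuous_const).max continuous_const).mul h2
  · have h0 : 0 ≤ max (KRdistSet dist μ M - r₀) 0 := le_max_right _ _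
    rw [abs_mul, abs_of_nonneg h0]
    exact mul_le_of_le_one_right h0 ((hg μ).1.1 x)
  · simp only [integral_const_mul]
    rw [← mul_sub]
    rcases lt_or_ge (KRdistSet dist μ M) r₀ with h | h
    · rw [max_eq_right (by linarith), zero_mul]
      have h0 : 0 ≤ KRdistSet dist μ M := Real.sInf_nonneg <| by
        rintro _ ⟨ν', -, rfl⟩
        exact KRdist_nonneg μ ν'
      nlinarith
    · rw [max_eq_left (by linarith)]
      have := mul_le_mul_of_nonneg_left ((hg μ).2 h ν hν) (sub_nonneg.2 h)
      linarith
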